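/- For six points p_1,...,p_6 in the projective plane over a field, given by homogeneous coordinate vectors x_i = (x_{i,0}, x_{i,1}, x_{i,2}), the 6×6 determinant d_2 of the matrix whose i-th row is (x_{i,0}^2, x_{i,1}^2, x_{i,2}^2, x_{i,0}x_{i,1}, x_{i,0}x_{i,2}, x_{i,1}x_{i,2}) satisfies d_2 = -det [[m_{134} m_{156}, m_{135} m_{146}], [m_{234} m_{256}, m_{235} m_{246}]], where m_{ijk} denotes the 3×3 determinant of the matrix with rows x_i, x_j, x_k. -/

import Mathlib

open Matrix

variable {K : Type*} [Field K]

/-- The 3×3 minor `m_{ijk}` of six points in the plane: the determinant of the matrix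
with rows `x i`, `x j`, `x k`. -/
def minor3 (x : Fin 6 → Fin 3 → K) (i j k : Fin 6) : K :=
  Matrix.det (Matrix.of ![x i, x j, x k])

/-- The determinant `d₂` of the 6×6 matrix whose `i`-th row consists of the six degree-2
monomials in the coordinates of the `i`-th point. -/
def dTwo (x : Fin 6 → Fin 3 → K) : K :=
  Matrix.det (Matrix.of fun i j =>
    ![x i 0 ^ 2, x i 1 ^ 2, x i 2 ^ 2, x i 0 * x i 1, x i 0 * x i 2, x i 1 * x i 2] j)

/-- Cofactor expansion of a 4×4 determinant along its first row. -/
theorem det_fin_four_expand {R : Type*} [CommRing R] (A : Matrix (Fin 4) (Fin 4) R) :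
    A.det = A 0 0 * (A.submatrix Fin.succ ![1, 2, 3]).det
      - A 0 1 * (A.submatrix Fin.succ ![0, 2, 3]).det
      + A 0 2 * (A.submatrix Fin.succ ![0, 1, 3]).det
      - A 0 3 * (A.submatrix Fin.succ ![0, 1, 2]).det := by
  have h0 : (Fin.succAbove 0 : Fin 3 → Fin 4) = ![1, 2, 3] := by decide
  have h1 : (Fin.succAbove 1 : Fin 3 → Fin 4) = ![0, 2, 3] := by decide
  have h2 : (Fin.succAbove 2 : Fin 3 → Fin 4) = ![0, 1, 3] := by decide
  have h3 : (Fin.succAbove 3 : Fin 3 → Fin 4) = ![0, 1, 2] := by decide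
  rw [det_succ_row_zero, Fin.sum_univ_four, h0, h1, h2, h3]
  simp [pow_succ]
  ring

/-- Cofactor expansion of a 5×5 determinant along its first row. -/
theorem det_fin_five_expand {R : Type*} [CommRing R] (A : Matrix (Fin 5) (Fin 5) R) :
    A.det = A 0 0 * (A.submatrix Fin.succ ![1, 2, 3, 4]).det
      - A 0 1 * (A.submatrix Fin.succ ![0, 2, 3, 4]).det
      + A 0 2 * (A.submatrix Fin.succ ![0, 1, 3, 4]).det
      - A 0 3 * (A.submatrix Fin.succ ![0, 1, 2, 4]).det
      + A 0 4 * (A.submatrix Fin.succ ![0, 1, 2, 3]).det := by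
  have h0 : (Fin.succAbove 0 : Fin 4 → Fin 5) = ![1, 2, 3, 4] := by decide
  have h1 : (Fin.succAbove 1 : Fin 4 → Fin 5) = ![0, 2, 3, 4] := by decide
  have h2 : (Fin.succAbove 2 : Fin 4 → Fin 5) = ![0, 1, 3, 4] := by decide
  have h3 : (Fin.succAbove 3 : Fin 4 → Fin 5) = ![0, 1, 2, 4] := by decide
  have h4 : (Fin.succAbove 4 : Fin 4 → Fin 5) = ![0, 1, 2, 3] := by decide
  rw [det_succ_row_zero, Fin.sum_univ_five, h0, h1, h2, h3, h4]
  simp [pow_succ]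
  ring

/-- Cofactor expansion of a 6×6 determinant along its first row. -/
theorem det_fin_six_expand {R : Type*} [CommRing R] (A : Matrix (Fin 6) (Fin 6) R) :
    A.det = A 0 0 * (A.submatrix Fin.succ ![1, 2, 3, 4, 5]).det
      - A 0 1 * (A.submatrix Fin.succ ![0, 2, 3, 4, 5]).det
      + A 0 2 * (A.submatrix Fin.succ ![0, 1, 3, 4, 5]).det
      - A 0 3 * (A.submatrix Fin.succ ![0, 1, 2, 4, 5]).det
      + A 0 4 * (A.submatrix Fin.succ ![0, 1, 2, 3, 5]).det
      - A 0 5 * (A.submatrix Fin.succ ![0, 1, 2, 3, 4]).det := by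
  have h0 : (Fin.succAbove 0 : Fin 5 → Fin 6) = ![1, 2, 3, 4, 5] := by decide
  have h1 : (Fin.succAbove 1 : Fin 5 → Fin 6) = ![0, 2, 3, 4, 5] := by decide
  have h2 : (Fin.succAbove 2 : Fin 5 → Fin 6) = ![0, 1, 3, 4, 5] := by decide
  have h3 : (Fin.succAbove 3 : Fin 5 → Fin 6) = ![0, 1, 2, 4, 5] := by decide
  have h4 : (Fin.succAbove 4 : Fin 5 → Fin 6) = ![0, 1, 2, 3, 5] := by decide
  have h5 : (Fin.succAbove 5 : Fin 5 → Fin 6) = ![0, 1, 2, 3, 4] := by decide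
  rw [det_succ_row_zero, Fin.sum_univ_six, h0, h1, h2, h3, h4, h5]
  simp [pow_succ]
  ring

set_option maxHeartbeats 1000000 in
/-- Coble's relation
`d₂ = -det [[m₁₃₄ m₁₅₆, m₁₃₅ m₁₄₆], [m₂₃₄ m₂₅₆, m₂₃₅ m₂₄₆]]`
(indices here are 0-based), as a polynomial identity in the 18 coordinates of six points
in the projective plane over a field. -/
theorem dTwo_eq_neg_det_minors (x : Fin 6 → Fin 3 → K) :
    dTwo x =
      - Matrix.det !![minor3 x 0 2 3 * minor3 x 0 4 5, minor3 x 0 2 4 * minor3 x 0 3 5;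
                      minor3 x 1 2 3 * minor3 x 1 4 5, minor3 x 1 2 4 * minor3 x 1 3 5] := by
  simp only [dTwo, minor3, det_fin_two_of, det_fin_six_expand, det_fin_five_expand,
    det_fin_four_expand, det_fin_three, submatrix_apply, of_apply]
  simp
  ring
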